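/- Let λ ∈ ℂ_p with |λ| = 1 and λ not a root of unity, and let k ≥ 2 be an integer such that (k-1)/(m p^s) is a non-negative integer power of p. Then ( Π_{n=1}^{k-1} |1 - λ^n| )^{-1} = p^{-1/(p-1)} · r̃(λ)^{-(k-1)}. -/

import Mathlib

open scoped BigOperators

noncomputable section

/-- `R(s) = p^{-1/(p^{s-1}(p-1))}` for `s ≥ 1`, and `R(0) = 0`. -/
def Rr (p : ℕ) (s : ℕ) : ℝ :=
  if s = 0 then 0 else (p : ℝ) ^ (-(1 : ℝ) / ((p : ℝ) ^ (s - 1) * ((p : ℝ) - 1)))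

/-- The group `Γ_r` of `p`-power roots of unity. -/
def GammaR (p : ℕ) (K : Type*) [Monoid K] : Set K := {z | ∃ k : ℕ, z ^ p ^ k = 1}

/-- The quantity `r̃(λ)`. -/
def rTilde {K : Type*} [NontriviallyNormedField K] (p : ℕ) (lam γ₀ : K) (m s t : ℕ) : ℝ :=
  Rr p (s + 1) ^ ((1 : ℝ) / m) *
    (p : ℝ) ^ (-(((s : ℝ) - (t : ℝ)) / ((m : ℝ) * (p : ℝ) ^ s))) *
    ‖1 - lam ^ m‖ ^ ((s : ℝ) * ((p : ℝ) - 1) / ((m : ℝ) * (p : ℝ))) *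
    ‖γ₀ - lam ^ m‖ ^ ((1 : ℝ) / ((m : ℝ) * (p : ℝ) ^ ((s : ℝ) - (t : ℝ))))

/-- Coefficient of `x^k` in the formal composition `H ∘ F`, where `H, F` are given by their
coefficient sequences `b, c` and `F` has zero constant term. -/
def compCoeff {K : Type*} [Field K] (b c : ℕ → K) (k : ℕ) : K :=
  ∑ l ∈ Finset.range (k + 1), b l * PowerSeries.coeff k ((PowerSeries.mk c) ^ l)

/-- `b` is (the coefficient sequence of) the normalized formal linearizing conjugacy `H_f` for the
power series `f` with coefficient sequence `c`: `H(0)=0`, `H'(0)=1` and `H ∘ f = λ·H` as formal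
power series. -/
def IsConjugacy {K : Type*} [Field K] (lam : K) (c b : ℕ → K) : Prop :=
  b 0 = 0 ∧ b 1 = 1 ∧ ∀ k, compCoeff b c k = lam * b k

/-- Evaluation of the power series with coefficients `b` at `x`. -/
def pEval {K : Type*} [NontriviallyNormedField K] (b : ℕ → K) (x : K) : K :=
  ∑' k, b k * x ^ k

/-- `f` is analytically linearizable on `U` (a disk about `0`): `f` maps `U` to itself and some
convergent power series `h` with `h(0)=0`, `h'(0)=1` maps `U` bijectively onto itself and
conjugates `f` to `x ↦ λx` on `U`. -/
def LinearizableOn {K : Type*} [NontriviallyNormedField K] (f : K → K) (lam : K)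
    (U : Set K) : Prop :=
  Set.MapsTo f U U ∧
    ∃ b : ℕ → K, b 0 = 0 ∧ b 1 = 1 ∧
      (∀ x ∈ U, Summable fun k => b k * x ^ k) ∧
      Set.BijOn (pEval b) U U ∧
      ∀ x ∈ U, pEval b (f x) = lam * pEval b x

/-- A disk about `0`: an open or closed ball centered at the origin. -/
def IsZeroDisk {K : Type*} [NontriviallyNormedField K] (U : Set K) : Prop :=
  ∃ ρ : ℝ, U = Metric.ball (0 : K) ρ ∨ U = Metric.closedBall (0 : K) ρ

/-- `x` is a periodic point of `f` of minimal period `q`. -/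
def IsMinPeriodicPt {K : Type*} (f : K → K) (q : ℕ) (x : K) : Prop :=
  f^[q] x = x ∧ ∀ j, 1 ≤ j → j < q → f^[j] x ≠ x

/-- The valuation `ν(x) = -log_p |x|`. -/
def nuP {K : Type*} [NontriviallyNormedField K] (p : ℕ) (z : K) : ℝ :=
  -Real.logb p ‖z‖

/-- `κ_n = -(ν(1-λ^{p^n}) - ν(1-λ^{p^{n-1}}))/p^n`. -/
def kappaN {K : Type*} [NontriviallyNormedField K] (p : ℕ) (lam : K) (n : ℕ) : ℝ :=
  -(nuP p (1 - lam ^ p ^ n) - nuP p (1 - lam ^ p ^ (n - 1))) / (p : ℝ) ^ n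

open Classical in
/-- The multiplicity of `x` as a zero of the analytic function `g`. -/
def analyticMult {K : Type*} [NontriviallyNormedField K] (g : K → K) (x : K) : ℕ :=
  if h : AnalyticAt K g x then (analyticOrderAt g x).toNat else 0

/-- The radius `r(P_λ) = |1-λ|^{-1/p}·r̃(λ)` of quadratic linearization disks. -/
def rQuad {K : Type*} [NontriviallyNormedField K] (p : ℕ) (lam γ₀ : K) (m s t : ℕ) : ℝ :=
  ‖1 - lam‖ ^ (-(1 : ℝ) / (p : ℝ)) * rTilde p lam γ₀ m s t

/-- The quantity `Ψ(λ) = |1-λ|^{-1/p}·p^{-(s-t)/p^s}·|γ₀-λ|^{1/p^{s-t}}` (case `m = 1`). -/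
def PsiL {K : Type*} [NontriviallyNormedField K] (p : ℕ) (lam γ₀ : K) (s t : ℕ) : ℝ :=
  ‖1 - lam‖ ^ (-(1 : ℝ) / (p : ℝ)) *
    (p : ℝ) ^ (-(((s : ℝ) - (t : ℝ)) / (p : ℝ) ^ s)) *
    ‖γ₀ - lam‖ ^ ((1 : ℝ) / (p : ℝ) ^ ((s : ℝ) - (t : ℝ)))

/-- Coefficient sequence of the quadratic polynomial `P_λ(x) = λx + x²`. -/
def quadCoeff {K : Type*} [Field K] (lam : K) : ℕ → K :=
  fun i => if i = 1 then lam else if i = 2 then 1 else 0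

/-- `δ(z) = (k-1)/z - ⌊(k-1)/z⌋` as a rational number. -/
def deltaFrac (k z : ℕ) : ℚ :=
  ((k : ℚ) - 1) / (z : ℚ) - (((k - 1) / z : ℕ) : ℚ)

end

theorem prod_Icc_mul_eq {q : ℕ} (hq : 0 < q) (N : ℕ) (g : ℕ → ℝ) :
    ∏ n ∈ Finset.Icc 1 (q * N), g n =
      (∏ n ∈ (Finset.Icc 1 (q * N)).filter (fun n => ¬ q ∣ n), g n) *
        ∏ j ∈ Finset.Icc 1 N, g (q * j) := by
  have himage : (Finset.Icc 1 (q * N)).filter (fun n => q ∣ n) =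
      (Finset.Icc 1 N).image (fun j => q * j) := by
    ext n
    simp only [Finset.mem_filter, Finset.mem_Icc, Finset.mem_image]
    constructor
    · rintro ⟨⟨h1, h2⟩, j, rfl⟩
      exact ⟨j, ⟨Nat.pos_of_mul_pos_left h1, Nat.le_of_mul_le_mul_left h2 hq⟩, rfl⟩
    · rintro ⟨j, ⟨h1, h2⟩, rfl⟩
      exact ⟨⟨Nat.mul_pos hq h1, Nat.mul_le_mul_left q h2⟩, dvd_mul_right q j⟩
  rw [← Finset.prod_filter_not_mul_prod_filter _ (fun n => q ∣ n), himage,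
    Finset.prod_image fun a _ b _ h => Nat.eq_of_mul_eq_mul_left hq h]

theorem card_filter_not_dvd_Icc {q : ℕ} (hq : 0 < q) (N : ℕ) :
    ((Finset.Icc 1 (q * N)).filter (fun n => ¬ q ∣ n)).card = (q - 1) * N := by
  have h := Finset.card_filter_add_card_filter_not (s := Finset.Icc 1 (q * N)) (fun n => q ∣ n)
  have h2 := Nat.Ioc_filter_dvd_card_eq_div (q * N) q
  rw [Nat.mul_div_cancel_left _ hq] at h2
  have h3 : Finset.Ioc 0 (q * N) = Finset.Icc 1 (q * N) := rfl
  rw [h3] at h2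
  rw [h2, Nat.card_Icc] at h
  rw [Nat.sub_mul]
  omega

theorem pow_le_norm_one_sub_pow {K : Type*} [NormedField K] [IsAlgClosed K] {u : K} {n : ℕ} (hn : n ≠ 0) {e : ℝ}
    (he : 0 ≤ e) (h : ∀ z : K, z ^ n = 1 → e ≤ ‖u - z‖) : e ^ n ≤ ‖1 - u ^ n‖ := by
  have hmonic : (Polynomial.X ^ n - Polynomial.C (1 : K)).Monic :=
    Polynomial.monic_X_pow_sub_C 1 hn
  have hsplits := IsAlgClosed.splits (Polynomial.X ^ n - Polynomial.C (1 : K))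
  have heval := hsplits.eval_eq_prod_roots_of_monic hmonic u
  have hcard := hsplits.natDegree_eq_card_roots
  rw [Polynomial.natDegree_X_pow_sub_C] at hcard
  have hbound : ∀ S : Multiset K, (∀ z ∈ S, e ≤ ‖u - z‖) →
      e ^ S.card ≤ ‖(S.map (u - ·)).prod‖ := by
    intro S
    induction S using Multiset.induction_on with
    | empty => simp
    | cons a S ih =>
      intro hS
      rw [Multiset.card_cons, Multiset.map_cons, Multiset.prod_cons, norm_mul, pow_succ']
      exact mul_le_mul (hS a (Multiset.mem_cons_self a S))
        (ih fun z hz => hS z (Multiset.mem_cons_of_mem hz)) (by positivity) (norm_nonneg _)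
  have hroots := hbound (Polynomial.X ^ n - Polynomial.C (1 : K)).roots fun z hz => h z <| by
    simpa [sub_eq_zero] using (Polynomial.mem_roots'.mp hz).2
  rw [← hcard, ← heval] at hroots
  rw [norm_sub_rev]
  simpa using hroots

theorem norm_eq_one_of_mem_GammaR {K : Type*} [NormedField K] {p : ℕ} (hp : p.Prime) {z : K}
    (hz : z ∈ GammaR p K) : ‖z‖ = 1 := by
  obtain ⟨k, hk⟩ := hz
  exact (pow_eq_one_iff_of_nonneg (norm_nonneg z) (pow_ne_zero k hp.ne_zero)).mp
    (by rw [← norm_pow, hk, norm_one])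

section Ultrametric

variable {K : Type*} [NontriviallyNormedField K] [IsUltrametricDist K]

theorem norm_eq_one_of_norm_one_sub_lt_one {u : K} (hu : ‖1 - u‖ < 1) : ‖u‖ = 1 := by
  have h := IsUltrametricDist.norm_eq_of_add_norm_lt_max (x := 1) (y := -u)
    (by rw [← sub_eq_add_neg]; exact hu.trans_le (by simp))
  simpa using h.symm

theorem norm_one_sub_pow_le {u : K} (hu : ‖u‖ ≤ 1) (n : ℕ) : ‖1 - u ^ n‖ ≤ ‖1 - u‖ := by
  rw [← mul_neg_geom_sum, norm_mul]
  refine mul_le_of_le_one_right (norm_nonneg _) ?_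
  refine IsUltrametricDist.norm_sum_le_of_forall_le_of_nonneg zero_le_one fun i _ => ?_
  rw [norm_pow]
  exact pow_le_one₀ (norm_nonneg _) hu

theorem norm_one_sub_pow_of_norm_natCast_eq_one {u : K} (hu : ‖1 - u‖ < 1) {n : ℕ}
    (hn : ‖(n : K)‖ = 1) : ‖1 - u ^ n‖ = ‖1 - u‖ := by
  have hu1 := norm_eq_one_of_norm_one_sub_lt_one hu
  rw [← mul_neg_geom_sum, norm_mul]
  suffices h : ‖∑ i ∈ Finset.range n, u ^ i‖ = 1 by rw [h, mul_one]
  have hsub : ‖(n : K) - ∑ i ∈ Finset.range n, u ^ i‖ < 1 := by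
    have heq : (n : K) - ∑ i ∈ Finset.range n, u ^ i = ∑ i ∈ Finset.range n, (1 - u ^ i) := by
      simp
    rw [heq]
    exact (IsUltrametricDist.norm_sum_le_of_forall_le_of_nonneg (norm_nonneg _)
      fun i _ => norm_one_sub_pow_le hu1.le i).trans_lt hu
  have h := IsUltrametricDist.norm_eq_of_add_norm_lt_max (x := (n : K))
    (y := -∑ i ∈ Finset.range n, u ^ i)
    (by rw [← sub_eq_add_neg]; exact hsub.trans_le (by simp [hn]))
  rw [norm_neg, hn] at h
  exact h.symm

/-- If the residue of `z` has order `m`, then `1 - z ^ n` is a unit unless `m ∣ n`. -/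
theorem norm_one_sub_pow_eq_one_of_not_dvd {z : K} (hz : ‖z‖ = 1) {m : ℕ}
    (hm : IsLeast {n : ℕ | 1 ≤ n ∧ ‖1 - z ^ n‖ < 1} m) {n : ℕ} (hn : ¬ m ∣ n) :
    ‖1 - z ^ n‖ = 1 := by
  obtain ⟨⟨hm1, hmlt⟩, hleast⟩ := hm
  have hle : ‖1 - z ^ n‖ ≤ 1 := by
    have h := IsUltrametricDist.norm_add_le_max 1 (-z ^ n)
    rw [← sub_eq_add_neg] at h
    simpa [hz] using h
  refine hle.antisymm (not_lt.mp fun hlt => ?_)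
  have hr0 : 1 ≤ n % m := Nat.pos_of_ne_zero fun h => hn (Nat.dvd_of_mod_eq_zero h)
  refine absurd (hleast ⟨hr0, ?_⟩) (not_le.mpr (Nat.mod_lt n hm1))
  have hq : ‖1 - z ^ (m * (n / m))‖ < 1 := by
    rw [pow_mul]
    exact (norm_one_sub_pow_le (by simp [hz]) _).trans_lt hmlt
  have hsplit : 1 - z ^ (n % m) =
      (1 - z ^ n) + -(z ^ (n % m) * (1 - z ^ (m * (n / m)))) := by
    rw [mul_sub, ← pow_add, Nat.mod_add_div]
    ring
  rw [hsplit]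
  refine (IsUltrametricDist.norm_add_le_max _ _).trans_lt (max_lt hlt ?_)
  simpa [hz] using hq

theorem norm_one_add_pow_prime_sub {p : ℕ} (hp : p.Prime) {x : K} (hx : ‖x‖ < 1) :
    ‖(1 + x) ^ p - 1 - x ^ p‖ = ‖(p : K)‖ * ‖x‖ := by
  rcases eq_or_ne x 0 with rfl | hx0
  · simp [hp.ne_zero]
  have hexp : (1 + x) ^ p - 1 - x ^ p =
      p * ∑ k ∈ Finset.Ioo 0 p, x ^ k * ((p.choose k / p : ℕ) : K) := by
    rw [add_comm, add_pow_prime_eq' hp]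
    simp only [one_pow, mul_one]
    ring
  have hmem : 1 ∈ Finset.Ioo 0 p := by simp [hp.one_lt]
  rw [hexp, norm_mul, ← Finset.add_sum_erase _ _ hmem]
  congr 1
  have hrest : ‖∑ k ∈ (Finset.Ioo 0 p).erase 1, x ^ k * ((p.choose k / p : ℕ) : K)‖ ≤
      ‖x‖ ^ 2 := by
    refine IsUltrametricDist.norm_sum_le_of_forall_le_of_nonneg (by positivity) fun k hk => ?_
    simp only [Finset.mem_erase, Finset.mem_Ioo] at hk
    rw [norm_mul, norm_pow]
    calc ‖x‖ ^ k * ‖((p.choose k / p : ℕ) : K)‖ ≤ ‖x‖ ^ k * 1 := by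
          gcongr
          exact IsUltrametricDist.norm_natCast_le_one K _
      _ = ‖x‖ ^ k := mul_one _
      _ ≤ ‖x‖ ^ 2 := pow_le_pow_of_le_one (norm_nonneg _) hx.le (by omega)
  have hfirst : x ^ 1 * ((p.choose 1 / p : ℕ) : K) = x := by
    simp [Nat.div_self hp.pos]
  rw [hfirst]
  have hlt : ‖x‖ ^ 2 < ‖x‖ := by
    have := norm_pos_iff.mpr hx0
    nlinarith
  rw [IsUltrametricDist.norm_add_eq_max_of_norm_ne_norm (hrest.trans_lt hlt).ne']
  exact max_eq_left (hrest.trans_lt hlt).le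

variable {p : ℕ}

theorem norm_pow_prime_sub_sub (hp : p.Prime) (hpK : ‖(p : K)‖ = (p : ℝ)⁻¹) {u : K}
    (hu : ‖1 - u‖ < 1) : ‖u ^ p - 1 - (u - 1) ^ p‖ = (p : ℝ)⁻¹ * ‖1 - u‖ := by
  have h := norm_one_add_pow_prime_sub hp (x := u - 1) (by rwa [norm_sub_rev])
  rwa [add_sub_cancel, hpK, norm_sub_rev u 1] at h

theorem norm_one_sub_pow_prime_le (hp : p.Prime) (hpK : ‖(p : K)‖ = (p : ℝ)⁻¹) {u : K}
    (hu : ‖1 - u‖ < 1) : ‖1 - u ^ p‖ ≤ max ((p : ℝ)⁻¹ * ‖1 - u‖) (‖1 - u‖ ^ p) := by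
  have h := IsUltrametricDist.norm_add_le_max (u ^ p - 1 - (u - 1) ^ p) ((u - 1) ^ p)
  rwa [sub_add_cancel, norm_pow_prime_sub_sub hp hpK hu, norm_pow, norm_sub_rev,
    norm_sub_rev u 1] at h

theorem norm_one_sub_pow_prime_of_ne (hp : p.Prime) (hpK : ‖(p : K)‖ = (p : ℝ)⁻¹) {u : K}
    (hu : ‖1 - u‖ < 1) (hne : (p : ℝ)⁻¹ * ‖1 - u‖ ≠ ‖1 - u‖ ^ p) :
    ‖1 - u ^ p‖ = max ((p : ℝ)⁻¹ * ‖1 - u‖) (‖1 - u‖ ^ p) := by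
  have h := IsUltrametricDist.norm_add_eq_max_of_norm_ne_norm
    (x := u ^ p - 1 - (u - 1) ^ p) (y := (u - 1) ^ p)
    (by rwa [norm_pow_prime_sub_sub hp hpK hu, norm_pow, norm_sub_rev u 1])
  rwa [sub_add_cancel, norm_pow_prime_sub_sub hp hpK hu, norm_pow, norm_sub_rev,
    norm_sub_rev u 1] at h

theorem norm_one_sub_pow_prime_of_gt (hp : p.Prime) (hpK : ‖(p : K)‖ = (p : ℝ)⁻¹) {u : K}
    (hu : ‖1 - u‖ < 1) (h : (p : ℝ)⁻¹ < ‖1 - u‖ ^ (p - 1)) :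
    ‖1 - u ^ p‖ = ‖1 - u‖ ^ p := by
  have hp0 : (0 : ℝ) < (p : ℝ)⁻¹ := by have := hp.pos; positivity
  have hpos : 0 < ‖1 - u‖ := by
    refine (norm_nonneg _).lt_of_ne fun h0 => ?_
    rw [← h0, zero_pow (by have := hp.two_le; omega)] at h
    exact h.not_gt hp0
  have hlt : (p : ℝ)⁻¹ * ‖1 - u‖ < ‖1 - u‖ ^ p := by
    rw [← pow_sub_one_mul hp.ne_zero]
    gcongr
  rw [norm_one_sub_pow_prime_of_ne hp hpK hu hlt.ne, max_eq_right hlt.le]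

theorem norm_one_sub_pow_prime_of_lt (hp : p.Prime) (hpK : ‖(p : K)‖ = (p : ℝ)⁻¹) {u : K}
    (hu : ‖1 - u‖ < 1) (h : ‖1 - u‖ ^ (p - 1) < (p : ℝ)⁻¹) :
    ‖1 - u ^ p‖ = (p : ℝ)⁻¹ * ‖1 - u‖ := by
  rcases (norm_nonneg (1 - u)).eq_or_lt with h0 | hpos
  · rw [← h0, mul_zero]
    have hu1 : u = 1 := (sub_eq_zero.mp (norm_eq_zero.mp h0.symm)).symm
    simp [hu1]
  have hlt : ‖1 - u‖ ^ p < (p : ℝ)⁻¹ * ‖1 - u‖ := by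
    rw [← pow_sub_one_mul hp.ne_zero]
    gcongr
  rw [norm_one_sub_pow_prime_of_ne hp hpK hu hlt.ne', max_eq_left hlt.le]

theorem norm_one_sub_pow_lt_one {u : K} (hu : ‖1 - u‖ < 1) (n : ℕ) : ‖1 - u ^ n‖ < 1 :=
  (norm_one_sub_pow_le (norm_eq_one_of_norm_one_sub_lt_one hu).le n).trans_lt hu

theorem norm_one_sub_pow_prime_pow_lt (hp : p.Prime) (hpK : ‖(p : K)‖ = (p : ℝ)⁻¹) {s : ℕ} :
    ∀ {u : K}, ‖1 - u‖ < 1 → ‖1 - u‖ ^ (p ^ s * (p - 1)) < (p : ℝ)⁻¹ →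
      ‖1 - u ^ p ^ s‖ ^ (p - 1) < (p : ℝ)⁻¹ := by
  have hp1 : p - 1 ≠ 0 := by have := hp.two_le; omega
  have hp0 : (0 : ℝ) < (p : ℝ)⁻¹ := by have := hp.pos; positivity
  have hple : (p : ℝ)⁻¹ ≤ 1 := inv_le_one_of_one_le₀ (by exact_mod_cast hp.one_le)
  induction s with
  | zero => intro u _ h; simpa using h
  | succ s ih =>
    intro u hu h
    rw [pow_succ', pow_mul]
    refine ih (norm_one_sub_pow_lt_one hu p) ?_
    have hn : p ^ s * (p - 1) ≠ 0 := mul_ne_zero (pow_ne_zero _ hp.ne_zero) hp1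
    rcases le_max_iff.mp (norm_one_sub_pow_prime_le hp hpK hu) with hle | hle
    · calc ‖1 - u ^ p‖ ^ (p ^ s * (p - 1)) ≤ ‖1 - u ^ p‖ :=
            pow_le_of_le_one (norm_nonneg _) (norm_one_sub_pow_lt_one hu p).le hn
        _ ≤ (p : ℝ)⁻¹ * ‖1 - u‖ := hle
        _ < (p : ℝ)⁻¹ := mul_lt_of_lt_one_right hp0 hu
    · calc ‖1 - u ^ p‖ ^ (p ^ s * (p - 1)) ≤ (‖1 - u‖ ^ p) ^ (p ^ s * (p - 1)) := by gcongr
        _ = ‖1 - u‖ ^ (p ^ (s + 1) * (p - 1)) := by rw [← pow_mul]; congr 1; ring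
        _ < (p : ℝ)⁻¹ := h

theorem norm_one_sub_pow_prime_pow_of_lt (hp : p.Prime) (hpK : ‖(p : K)‖ = (p : ℝ)⁻¹) {u : K}
    (hu : ‖1 - u‖ < 1) (h : ‖1 - u‖ ^ (p - 1) < (p : ℝ)⁻¹) (j : ℕ) :
    ‖1 - u ^ p ^ j‖ = (p : ℝ)⁻¹ ^ j * ‖1 - u‖ := by
  induction j with
  | zero => simp
  | succ j ih =>
    have hle := norm_one_sub_pow_le (norm_eq_one_of_norm_one_sub_lt_one hu).le (p ^ j)
    rw [pow_succ p, pow_mul, norm_one_sub_pow_prime_of_lt hp hpK (hle.trans_lt hu)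
      ((pow_le_pow_left₀ (norm_nonneg _) hle _).trans_lt h), ih]
    ring

/-- The only `p`-power roots of unity near `1` are those of small order. -/
theorem pow_prime_pow_eq_one_of_near (hp : p.Prime) (hpK : ‖(p : K)‖ = (p : ℝ)⁻¹) {s : ℕ}
    {z : K} (hz : z ∈ GammaR p K) (h1 : ‖1 - z‖ < 1)
    (h : ‖1 - z‖ ^ (p ^ s * (p - 1)) < (p : ℝ)⁻¹) : z ^ p ^ s = 1 := by
  obtain ⟨k, hk⟩ := hz
  have hp0 : (p : ℝ)⁻¹ ≠ 0 := inv_ne_zero (by exact_mod_cast hp.ne_zero)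
  have hpow := norm_one_sub_pow_prime_pow_of_lt hp hpK (norm_one_sub_pow_lt_one h1 (p ^ s))
    (norm_one_sub_pow_prime_pow_lt hp hpK h1 h) k
  rw [← pow_mul, mul_comm, pow_mul, hk, one_pow, sub_self, norm_zero] at hpow
  have h0 := (mul_eq_zero.mp hpow.symm).resolve_left (pow_ne_zero _ hp0)
  exact (sub_eq_zero.mp (norm_eq_zero.mp h0)).symm

theorem norm_one_sub_pow_prime_pow_le_pow (hp : p.Prime) (hpK : ‖(p : K)‖ = (p : ℝ)⁻¹) {u : K}
    (hu : ‖1 - u‖ < 1) {t : ℕ} (h : (p : ℝ)⁻¹ ≤ ‖1 - u‖ ^ (p ^ t * (p - 1))) {i : ℕ}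
    (hi : i ≤ t + 1) : ‖1 - u ^ p ^ i‖ ≤ ‖1 - u‖ ^ p ^ i := by
  induction i with
  | zero => simp
  | succ i ih =>
    have hle := ih (by omega)
    rw [pow_succ p, pow_mul, pow_mul]
    refine (norm_one_sub_pow_prime_le hp hpK (norm_one_sub_pow_lt_one hu _)).trans
      (max_le ?_ (by gcongr))
    have hpi : (p : ℝ)⁻¹ ≤ (‖1 - u‖ ^ p ^ i) ^ (p - 1) := by
      rw [← pow_mul]
      refine h.trans (pow_le_pow_of_le_one (norm_nonneg _) hu.le ?_)
      exact Nat.mul_le_mul_right _ (Nat.pow_le_pow_right hp.pos (by omega))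
    rw [← pow_sub_one_mul hp.ne_zero (‖1 - u‖ ^ p ^ i)]
    gcongr

theorem norm_one_sub_pow_prime_pow_eq_pow (hp : p.Prime) (hpK : ‖(p : K)‖ = (p : ℝ)⁻¹) {u : K}
    (hu : ‖1 - u‖ < 1) (hu0 : u ≠ 1) {t : ℕ} (h : (p : ℝ)⁻¹ ≤ ‖1 - u‖ ^ (p ^ t * (p - 1)))
    {i : ℕ} (hi : i ≤ t) : ‖1 - u ^ p ^ i‖ = ‖1 - u‖ ^ p ^ i := by
  induction i with
  | zero => simp
  | succ i ih =>
    have heq := ih (by omega)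
    rw [pow_succ p, pow_mul, pow_mul, ← heq]
    refine norm_one_sub_pow_prime_of_gt hp hpK (norm_one_sub_pow_lt_one hu _) ?_
    rw [heq, ← pow_mul]
    refine h.trans_lt (pow_lt_pow_right_of_lt_one₀ ?_ hu ?_)
    · exact norm_pos_iff.mpr (sub_ne_zero.mpr hu0.symm)
    · exact Nat.mul_lt_mul_of_pos_right (Nat.pow_lt_pow_right hp.one_lt (by omega))
        (by have := hp.two_le; omega)

theorem prod_norm_one_sub_pow_prime_pow_succ (hp : p.Prime)
    (hcop : ∀ n : ℕ, ¬ p ∣ n → ‖(n : K)‖ = 1) {u : K} (hu : ‖1 - u‖ < 1) (M : ℕ) :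
    ∏ j ∈ Finset.Icc 1 (p ^ (M + 1)), ‖1 - u ^ j‖ =
      ‖1 - u‖ ^ ((p - 1) * p ^ M) * ∏ j ∈ Finset.Icc 1 (p ^ M), ‖1 - (u ^ p) ^ j‖ := by
  rw [pow_succ', prod_Icc_mul_eq hp.pos, ← card_filter_not_dvd_Icc hp.pos, ← Finset.prod_const]
  simp only [pow_mul]
  congr 1
  refine Finset.prod_congr rfl fun n hn => ?_
  exact norm_one_sub_pow_of_norm_natCast_eq_one hu (hcop n (Finset.mem_filter.mp hn).2)

theorem prod_norm_one_sub_pow_prime_pow_add (hp : p.Prime)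
    (hcop : ∀ n : ℕ, ¬ p ∣ n → ‖(n : K)‖ = 1) {s : ℕ} (a : ℕ) :
    ∀ {u : K}, ‖1 - u‖ < 1 →
      ∏ j ∈ Finset.Icc 1 (p ^ (s + a)), ‖1 - u ^ j‖ =
        (∏ i ∈ Finset.range s, ‖1 - u ^ p ^ i‖ ^ ((p - 1) * p ^ (s - 1 - i + a))) *
          ∏ j ∈ Finset.Icc 1 (p ^ a), ‖1 - (u ^ p ^ s) ^ j‖ := by
  induction s with
  | zero => simp
  | succ s ih =>
    intro u hu
    rw [add_right_comm, prod_norm_one_sub_pow_prime_pow_succ hp hcop hu,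
      ih (norm_one_sub_pow_lt_one hu p), Finset.prod_range_succ', ← mul_assoc,
      mul_comm (‖1 - u‖ ^ _)]
    simp only [← pow_mul, ← pow_succ']
    congr 2
    · refine Finset.prod_congr rfl fun i _ => ?_
      congr 4
      omega
    · simp

theorem prod_norm_one_sub_pow_of_lt (hp : p.Prime) (hpK : ‖(p : K)‖ = (p : ℝ)⁻¹)
    (hcop : ∀ n : ℕ, ¬ p ∣ n → ‖(n : K)‖ = 1) {a : ℕ} :
    ∀ {u : K}, ‖1 - u‖ < 1 → ‖1 - u‖ ^ (p - 1) < (p : ℝ)⁻¹ →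
      ∏ j ∈ Finset.Icc 1 (p ^ a), ‖1 - u ^ j‖ =
        (p : ℝ)⁻¹ ^ (∑ i ∈ Finset.range a, p ^ i) * ‖1 - u‖ ^ p ^ a := by
  induction a with
  | zero => simp
  | succ a ih =>
    intro u hu h
    have hstep := norm_one_sub_pow_prime_of_lt hp hpK hu h
    have hle := norm_one_sub_pow_le (norm_eq_one_of_norm_one_sub_lt_one hu).le p
    rw [prod_norm_one_sub_pow_prime_pow_succ hp hcop hu, ih (hle.trans_lt hu)
      ((pow_le_pow_left₀ (norm_nonneg _) hle _).trans_lt h), hstep, Finset.sum_range_succ,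
      mul_pow, pow_add]
    have hexp : p ^ (a + 1) = (p - 1) * p ^ a + p ^ a := by
      rw [← Nat.succ_mul, Nat.succ_eq_add_one, Nat.sub_add_cancel hp.one_le, pow_succ']
    rw [hexp, pow_add]
    ring

end Ultrametric

section Radii

variable {p : ℕ}

theorem Rr_succ_pow (hp : p.Prime) (s : ℕ) :
    Rr p (s + 1) ^ (p ^ s * (p - 1)) = (p : ℝ)⁻¹ := by
  have hp1 : (1 : ℝ) < p := by exact_mod_cast hp.one_lt
  have hp0 : (0 : ℝ) < p := by positivity
  have hsub : (p : ℝ) - 1 ≠ 0 := by linarith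
  rw [Rr, if_neg s.succ_ne_zero, Nat.add_sub_cancel, ← Real.rpow_natCast, ← Real.rpow_mul hp0.le,
    ← Real.rpow_neg_one]
  congr 1
  push_cast [Nat.cast_sub hp.one_le]
  field_simp

theorem Rr_nonneg (p s : ℕ) : 0 ≤ Rr p s := by
  unfold Rr
  split_ifs <;> positivity

theorem Rr_succ_exponent_ne_zero (hp : p.Prime) (s : ℕ) : p ^ s * (p - 1) ≠ 0 :=
  mul_ne_zero (pow_ne_zero _ hp.ne_zero) (by have := hp.two_le; omega)

theorem lt_Rr_succ_iff (hp : p.Prime) {s : ℕ} {d : ℝ} (hd : 0 ≤ d) :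
    d < Rr p (s + 1) ↔ d ^ (p ^ s * (p - 1)) < (p : ℝ)⁻¹ := by
  rw [← Rr_succ_pow hp s, pow_lt_pow_iff_left₀ hd (Rr_nonneg p _) (Rr_succ_exponent_ne_zero hp s)]

theorem Rr_succ_le_iff (hp : p.Prime) {s : ℕ} {d : ℝ} (hd : 0 ≤ d) :
    Rr p (s + 1) ≤ d ↔ (p : ℝ)⁻¹ ≤ d ^ (p ^ s * (p - 1)) := by
  rw [← not_lt, lt_Rr_succ_iff hp hd, not_lt]

end Radii

section Distances

variable {K : Type*} [NontriviallyNormedField K] [IsUltrametricDist K] {p : ℕ}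

theorem norm_one_sub_pow_prime_pow_of_Rr_le (hp : p.Prime) (hpK : ‖(p : K)‖ = (p : ℝ)⁻¹) {u : K}
    (hu : ‖1 - u‖ < 1) (hu0 : u ≠ 1) {s i : ℕ} (hs : Rr p s ≤ ‖1 - u‖) (hi : i < s) :
    ‖1 - u ^ p ^ i‖ = ‖1 - u‖ ^ p ^ i := by
  obtain ⟨s, rfl⟩ := Nat.exists_eq_add_one_of_ne_zero (Nat.ne_zero_of_lt hi)
  exact norm_one_sub_pow_prime_pow_eq_pow hp hpK hu hu0
    ((Rr_succ_le_iff hp (norm_nonneg _)).mp hs) (by omega)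

/-- If `1` is a `p`-power root of unity closest to `u`, then raising to the power `p ^ t` acts on
the distance to `1` as a pure power as long as `R(t)` does not exceed that distance. -/
theorem norm_one_sub_pow_prime_pow_of_closest [IsAlgClosed K] (hp : p.Prime)
    (hpK : ‖(p : K)‖ = (p : ℝ)⁻¹) {u : K} (hu : ‖1 - u‖ < 1)
    (hmin : ∀ z ∈ GammaR p K, ‖1 - u‖ ≤ ‖z - u‖) {t : ℕ} (ht : Rr p t ≤ ‖1 - u‖) :
    ‖1 - u ^ p ^ t‖ = ‖1 - u‖ ^ p ^ t := by
  refine le_antisymm ?_ ?_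
  · cases t with
    | zero => simp
    | succ t =>
      exact norm_one_sub_pow_prime_pow_le_pow hp hpK hu
        ((Rr_succ_le_iff hp (norm_nonneg _)).mp ht) le_rfl
  · refine pow_le_norm_one_sub_pow (pow_ne_zero _ hp.ne_zero) (norm_nonneg _) fun z hz => ?_
    rw [norm_sub_rev u z]
    exact hmin z ⟨t, hz⟩

theorem le_of_Rr_lt (hp : p.Prime) {s t : ℕ} {d : ℝ} (hd : d < 1) (ht : Rr p t ≤ d)
    (hs : d < Rr p (s + 1)) : t ≤ s := by
  have hd0 : 0 ≤ d := (Rr_nonneg p t).trans ht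
  by_contra! hlt
  obtain ⟨t, rfl⟩ := Nat.exists_eq_add_one_of_ne_zero (Nat.ne_zero_of_lt hlt)
  have h1 := (Rr_succ_le_iff hp hd0).mp ht
  have h2 := (lt_Rr_succ_iff hp hd0).mp hs
  refine (h1.trans (pow_le_pow_of_le_one hd0 hd.le ?_)).not_gt h2
  exact Nat.mul_le_mul_right _ (Nat.pow_le_pow_right hp.pos (by omega))

theorem norm_one_sub_pow_prime_pow_eq_closest [IsAlgClosed K] (hp : p.Prime)
    (hpK : ‖(p : K)‖ = (p : ℝ)⁻¹) {u g : K} (hu : ‖1 - u‖ < 1) {s t : ℕ}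
    (hs : ‖1 - u‖ < Rr p (s + 1)) (hg : g ∈ GammaR p K)
    (hmin : ∀ z ∈ GammaR p K, ‖g - u‖ ≤ ‖z - u‖)
    (ht : Rr p t ≤ ‖g - u‖) (ht' : ‖g - u‖ < Rr p (t + 1)) (hts : t ≤ s) :
    ‖1 - u ^ p ^ s‖ = (p : ℝ)⁻¹ ^ (s - t) * ‖g - u‖ ^ p ^ t := by
  have hg1 := norm_eq_one_of_mem_GammaR hp hg
  have hg0 : g ≠ 0 := norm_ne_zero_iff.mp (by rw [hg1]; exact one_ne_zero)
  have hle : ‖g - u‖ ≤ ‖1 - u‖ := hmin 1 ⟨0, by simp⟩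
  have hgle : ‖1 - g‖ ≤ ‖1 - u‖ := by
    have h := IsUltrametricDist.norm_add_le_max (1 - u) (u - g)
    rwa [sub_add_sub_cancel, norm_sub_rev u g, max_eq_left hle] at h
  have hgpow : g ^ p ^ s = 1 := pow_prime_pow_eq_one_of_near hp hpK hg (hgle.trans_lt hu)
    ((lt_Rr_succ_iff hp (norm_nonneg _)).mp (hgle.trans_lt hs))
  have hdist : ∀ z : K, ‖z - u / g‖ = ‖g * z - u‖ := fun z => by
    have hfac : g * z - u = g * (z - u / g) := by field_simp
    rw [hfac, norm_mul, hg1, one_mul]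
  have hdist1 : ‖1 - u / g‖ = ‖g - u‖ := by rw [hdist, mul_one]
  have hw : ‖1 - u / g‖ < 1 := hdist1 ▸ hle.trans_lt hu
  have hpt : ‖1 - (u / g) ^ p ^ t‖ = ‖g - u‖ ^ p ^ t := by
    rw [norm_one_sub_pow_prime_pow_of_closest hp hpK hw _ (hdist1 ▸ ht), hdist1]
    rintro z ⟨k, hk⟩
    obtain ⟨l, hl⟩ := hg
    rw [hdist1, hdist]
    refine hmin _ ⟨l + k, ?_⟩
    rw [mul_pow, pow_add, pow_mul, hl, one_pow, mul_comm (p ^ l), pow_mul z, hk, one_pow, one_mul]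
  have hlt := norm_one_sub_pow_prime_pow_lt hp hpK hw
    ((lt_Rr_succ_iff hp (norm_nonneg _)).mp (hdist1 ▸ ht'))
  have hups : (u / g) ^ p ^ s = u ^ p ^ s := by rw [div_pow, hgpow, div_one]
  rw [← hups, ← hpt, ← norm_one_sub_pow_prime_pow_of_lt hp hpK
    (norm_one_sub_pow_lt_one hw _) hlt, ← pow_mul, ← pow_add, Nat.add_sub_cancel' hts]

end Distances

/-- Lemma, the exact product value at `p`-power indices. If
`(k-1)/(mp^s)` is a non-negative integer power of `p`, then
`(Π_{n=1}^{k-1}|1-λ^n|)⁻¹ = p^{-1/(p-1)}·r̃(λ)^{-(k-1)}`. -/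
theorem stmt8 (p : ℕ) [Fact p.Prime]
    {K : Type*} [NontriviallyNormedField K] [IsUltrametricDist K] [CompleteSpace K]
    [IsAlgClosed K] [Algebra ℚ_[p] K]
    (hiso : ∀ x : ℚ_[p], ‖algebraMap ℚ_[p] K x‖ = ‖x‖)
    (hdense : Dense {x : K | IsAlgebraic ℚ_[p] x})
    (lam : K) (hlam : ‖lam‖ = 1) (hroot : ∀ n : ℕ, 1 ≤ n → lam ^ n ≠ 1)
    (m : ℕ) (hm : IsLeast {n : ℕ | 1 ≤ n ∧ ‖1 - lam ^ n‖ < 1} m)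
    (s : ℕ) (hs : Rr p s ≤ ‖1 - lam ^ m‖ ∧ ‖1 - lam ^ m‖ < Rr p (s + 1))
    (γ₀ : K) (hγ₀ : γ₀ ∈ GammaR p K)
    (hγmin : ∀ γ ∈ GammaR p K, ‖γ₀ - lam ^ m‖ ≤ ‖γ - lam ^ m‖)
    (t : ℕ) (ht : Rr p t ≤ ‖γ₀ - lam ^ m‖ ∧ ‖γ₀ - lam ^ m‖ < Rr p (t + 1))
    (k : ℕ) (hk : 2 ≤ k) (hpow : ∃ α : ℕ, k - 1 = m * p ^ s * p ^ α) :
    (∏ n ∈ Finset.Icc 1 (k - 1), ‖1 - lam ^ n‖)⁻¹ =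
      (p : ℝ) ^ (-(1 : ℝ) / ((p : ℝ) - 1)) *
        rTilde p lam γ₀ m s t ^ (-(((k : ℝ) - 1))) := by
  obtain ⟨a, ha⟩ := hpow
  have hp : p.Prime := Fact.out
  have hnorm : ∀ n : ℕ, ‖(n : K)‖ = ‖(n : ℚ_[p])‖ := fun n => by rw [← hiso, map_natCast]
  have hpK : ‖(p : K)‖ = (p : ℝ)⁻¹ := by rw [hnorm, Padic.norm_p]
  have hcop : ∀ n : ℕ, ¬ p ∣ n → ‖(n : K)‖ = 1 := fun n hn => by
    rw [hnorm, Padic.norm_natCast_eq_one_iff]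
    exact (Nat.Prime.coprime_iff_not_dvd hp).mpr hn
  have hm1 : 1 ≤ m := hm.1.1
  have hu : ‖1 - lam ^ m‖ < 1 := hm.1.2
  have hu0 : lam ^ m ≠ 1 := hroot m hm1
  have hle : ‖γ₀ - lam ^ m‖ ≤ ‖1 - lam ^ m‖ := hγmin 1 ⟨0, by simp⟩
  have hts : t ≤ s := le_of_Rr_lt hp (hle.trans_lt hu) ht.1 (hle.trans_lt hs.2)
  have hprod : ∏ n ∈ Finset.Icc 1 (k - 1), ‖1 - lam ^ n‖ =
      ‖1 - lam ^ m‖ ^ (s * ((p - 1) * p ^ (s - 1 + a))) *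
        ((p : ℝ)⁻¹ ^ (∑ i ∈ Finset.range a, p ^ i) *
          ((p : ℝ)⁻¹ ^ (s - t) * ‖γ₀ - lam ^ m‖ ^ p ^ t) ^ p ^ a) := by
    rw [ha, mul_assoc, ← pow_add, prod_Icc_mul_eq hm1, Finset.prod_eq_one, one_mul]
    · simp only [pow_mul lam m]
      rw [prod_norm_one_sub_pow_prime_pow_add hp hcop a hu,
        prod_norm_one_sub_pow_of_lt hp hpK hcop (norm_one_sub_pow_lt_one hu _)
          (norm_one_sub_pow_prime_pow_lt hp hpK hu
            ((lt_Rr_succ_iff hp (norm_nonneg _)).mp hs.2)),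
        norm_one_sub_pow_prime_pow_eq_closest hp hpK hu hs.2 hγ₀ hγmin ht.1 ht.2 hts]
      congr 1
      rw [mul_comm s, pow_mul, ← Finset.card_range s, ← Finset.prod_const, Finset.card_range]
      refine Finset.prod_congr rfl fun i hi => ?_
      have his := Finset.mem_range.mp hi
      rw [norm_one_sub_pow_prime_pow_of_Rr_le hp hpK hu hu0 hs.1 his, ← pow_mul, mul_left_comm,
        ← pow_add]
      congr 3
      omega
    · intro n hn
      exact norm_one_sub_pow_eq_one_of_not_dvd hlam hm (Finset.mem_filter.mp hn).2
  have hγ0 : 0 < ‖γ₀ - lam ^ m‖ := by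
    refine norm_pos_iff.mpr (sub_ne_zero.mpr fun h => ?_)
    obtain ⟨l, hl⟩ := hγ₀
    rw [h, ← pow_mul] at hl
    exact hroot _ (Nat.mul_pos hm1 (pow_pos hp.pos l)) hl
  have hd0 : 0 < ‖1 - lam ^ m‖ := norm_pos_iff.mpr (sub_ne_zero.mpr hu0.symm)
  have hp1 : (1 : ℝ) < p := by exact_mod_cast hp.one_lt
  have hp0 : (0 : ℝ) < p := by positivity
  have hpsub : (p : ℝ) - 1 ≠ 0 := by linarith
  have hm0 : (m : ℝ) ≠ 0 := by positivity
  have hkreal : (k : ℝ) - 1 = m * p ^ s * p ^ a := by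
    rw [← Nat.cast_one, ← Nat.cast_sub (by omega), ha]
    push_cast
    ring
  have hR : 0 < Rr p (s + 1) := hd0.trans hs.2
  have hlogR : Real.log (Rr p (s + 1)) = -1 / (p ^ s * ((p : ℝ) - 1)) * Real.log p := by
    rw [Rr, if_neg s.succ_ne_zero, Nat.add_sub_cancel, Real.log_rpow hp0]
  have hgeom : ((∑ i ∈ Finset.range a, p ^ i : ℕ) : ℝ) = ((p : ℝ) ^ a - 1) / (p - 1) := by
    push_cast
    exact geom_sum_eq hp1.ne' a
  have hspow : (s : ℝ) * (((p : ℝ) - 1) * p ^ (s - 1 + a)) = s * (p - 1) / p * (p ^ s * p ^ a) := by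
    cases s with
    | zero => simp
    | succ s =>
      rw [Nat.add_sub_cancel]
      field_simp
      ring
  have hpst : (p : ℝ) ^ ((s : ℝ) - (t : ℝ)) = p ^ s / p ^ t := by
    rw [Real.rpow_sub hp0, Real.rpow_natCast, Real.rpow_natCast]
  have hr : 0 < rTilde p lam γ₀ m s t := by
    unfold rTilde
    positivity
  rw [hprod]
  refine Real.log_injOn_pos (Set.mem_Ioi.mpr (by positivity)) (Set.mem_Ioi.mpr (by positivity)) ?_
  rw [Real.log_inv, Real.log_mul (by positivity) (by positivity), Real.log_pow,
    Real.log_mul (by positivity) (by positivity), Real.log_pow, Real.log_pow,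
    Real.log_mul (by positivity) (by positivity), Real.log_pow, Real.log_pow, Real.log_inv,
    Real.log_mul (by positivity) (by positivity), Real.log_rpow hp0, Real.log_rpow hr, rTilde,
    Real.log_mul (by positivity) (by positivity), Real.log_mul (by positivity) (by positivity),
    Real.log_mul (by positivity) (by positivity), Real.log_rpow hR, Real.log_rpow hp0,
    Real.log_rpow hd0, Real.log_rpow hγ0, hlogR, hgeom, hkreal, hpst, Nat.cast_sub hts]
  push_cast [Nat.cast_sub hp.one_le]
  rw [hspow]
  field_simp
  ring
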